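/- arXiv:2002.03252 — 5 statements merged into one kernel-verified Lean document; each statement's English description precedes it below -/
import Mathlib

section
/- Let D ⊆ ℝ, let f : D → ℝ be Lipschitz continuous with constant L ≥ 0, let x_1, …, x_S ∈ D be observation points with y_s = f(x_s) and y⁺ = max_s y_s, and let ū(x) = min_{1≤s≤S} (y_s + L·|x − x_s|). Let μ, σ : D → ℝ be functions with σ(x) ≥ 0 for all x ∈ D and σ(x) = 0 only if x ∈ {x_1, …, x_S}. Define the acquisition function q(x) = (μ(x) − y⁺ − ξ)·Φ((μ(x) − y⁺ − ξ)/σ(x)) + σ(x)·φ((μ(x) − y⁺ − ξ)/σ(x)) when σ(x) > 0 and q(x) = 0 when σ(x) = 0, where ξ ∈ ℝ. If μ(x) + σ(x) ≥ ū(x) + ξ for all x ∈ D, then the upper bound region U = {x ∈ D : ū(x) > y⁺} is contained in the search region S = {x ∈ D : q(x) > 0}. -/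
/-- The standard normal probability density function. -/
noncomputable def stdNormalPDF (z : ℝ) : ℝ :=
  (Real.sqrt (2 * Real.pi))⁻¹ * Real.exp (-(z ^ 2) / 2)

/-- The standard normal cumulative distribution function. -/
noncomputable def stdNormalCDF (z : ℝ) : ℝ := ∫ t in Set.Iic z, stdNormalPDF t

theorem stdNormalPDF_pos (z : ℝ) : 0 < stdNormalPDF z := by
  unfold stdNormalPDF
  positivity

theorem stdNormalPDF_eq_exp_neg_half_mul_sq :
    stdNormalPDF = fun z => (Real.sqrt (2 * Real.pi))⁻¹ * Real.exp (-(1 / 2) * z ^ 2) := by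
  funext z
  unfold stdNormalPDF
  ring_nf

theorem integrable_stdNormalPDF : MeasureTheory.Integrable stdNormalPDF := by
  rw [stdNormalPDF_eq_exp_neg_half_mul_sq]
  exact (integrable_exp_neg_mul_sq (by norm_num)).const_mul _

theorem integrable_mul_stdNormalPDF :
    MeasureTheory.Integrable (fun t => t * stdNormalPDF t) := by
  rw [stdNormalPDF_eq_exp_neg_half_mul_sq]
  refine ((integrable_mul_exp_neg_mul_sq (b := 1 / 2) (by norm_num)).const_mul
    (Real.sqrt (2 * Real.pi))⁻¹).congr (.of_forall fun t => ?_)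
  ring

theorem hasDerivAt_stdNormalPDF (z : ℝ) :
    HasDerivAt stdNormalPDF (-(z * stdNormalPDF z)) z := by
  have h : HasDerivAt (fun t : ℝ => -(t ^ 2) / 2) (-z) z :=
    ((hasDerivAt_pow 2 z).neg.div_const 2).congr_deriv (by norm_num; ring)
  exact (h.exp.const_mul (Real.sqrt (2 * Real.pi))⁻¹).congr_deriv (by unfold stdNormalPDF; ring)

theorem integral_Iic_mul_stdNormalPDF (z : ℝ) :
    ∫ t in Set.Iic z, t * stdNormalPDF t = -stdNormalPDF z := by
  have h := MeasureTheory.integral_Iic_of_hasDerivAt_of_tendsto' (a := z)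
    (fun t _ => hasDerivAt_stdNormalPDF t) integrable_mul_stdNormalPDF.neg.integrableOn
    (MeasureTheory.tendsto_zero_of_hasDerivAt_of_integrableOn_Iic (a := z)
      (fun t _ => hasDerivAt_stdNormalPDF t) integrable_mul_stdNormalPDF.neg.integrableOn
      integrable_stdNormalPDF.integrableOn)
  rw [MeasureTheory.integral_neg] at h
  linarith

/-- The expected improvement of a standard normal variable is positive:
`z Φ(z) + φ(z) = ∫ t ≤ z, (z - t) φ(t) > 0`. -/
theorem mul_stdNormalCDF_add_stdNormalPDF_pos (z : ℝ) :
    0 < z * stdNormalCDF z + stdNormalPDF z := by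
  have hint : MeasureTheory.Integrable (fun t => z * stdNormalPDF t - t * stdNormalPDF t) :=
    (integrable_stdNormalPDF.const_mul z).sub integrable_mul_stdNormalPDF
  have heq : ∫ t in Set.Iic z, (z * stdNormalPDF t - t * stdNormalPDF t)
      = z * stdNormalCDF z + stdNormalPDF z := by
    rw [MeasureTheory.integral_sub (integrable_stdNormalPDF.const_mul z).integrableOn
      integrable_mul_stdNormalPDF.integrableOn, MeasureTheory.integral_const_mul,
      integral_Iic_mul_stdNormalPDF, sub_neg_eq_add, stdNormalCDF]
  rw [← heq, MeasureTheory.integral_Iic_eq_integral_Iio,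
    MeasureTheory.setIntegral_pos_iff_support_of_nonneg_ae _ hint.integrableOn]
  · have hsub : Set.Iio z ⊆
        Function.support (fun t => z * stdNormalPDF t - t * stdNormalPDF t) ∩ Set.Iio z := by
      refine fun t ht => ⟨?_, ht⟩
      rw [Function.mem_support, ← sub_mul]
      exact (mul_pos (sub_pos.2 ht) (stdNormalPDF_pos t)).ne'
    refine lt_of_lt_of_le ?_ (MeasureTheory.measure_mono hsub)
    simp
  · refine (MeasureTheory.ae_restrict_mem measurableSet_Iio).mono fun t ht => ?_
    simp only [Pi.zero_apply, ← sub_mul]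
    exact (mul_pos (sub_pos.2 ht) (stdNormalPDF_pos t)).le

/-- if `μ(x) + σ(x) ≥ ū(x) + ξ` on `D`, with `σ ≥ 0` vanishing only at
observation points, then the upper bound region `U = {x ∈ D : ū(x) > y⁺}` is contained
in the search region `S = {x ∈ D : q(x) > 0}` of the expected improvement function. -/
theorem upper_bound_region_subset_search_region
    (D : Set ℝ) (f : ℝ → ℝ) (L : ℝ) (hL : 0 ≤ L)
    (hf : ∀ x ∈ D, ∀ x' ∈ D, |f x - f x'| ≤ L * |x - x'|)
    (S : ℕ) (hS : 0 < S) (xs : Fin S → ℝ) (hxs : ∀ s, xs s ∈ D)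
    (μ σ : ℝ → ℝ) (ξ : ℝ)
    (hσnonneg : ∀ x ∈ D, 0 ≤ σ x)
    (hσzero : ∀ x ∈ D, σ x = 0 → ∃ s : Fin S, x = xs s)
    (hdom : ∀ x ∈ D,
      (Finset.univ : Finset (Fin S)).inf' ⟨⟨0, hS⟩, Finset.mem_univ _⟩
          (fun s => f (xs s) + L * |x - xs s|) + ξ ≤ μ x + σ x) :
    {x | x ∈ D ∧
        (Finset.univ : Finset (Fin S)).sup' ⟨⟨0, hS⟩, Finset.mem_univ _⟩ (fun s => f (xs s))
          < (Finset.univ : Finset (Fin S)).inf' ⟨⟨0, hS⟩, Finset.mem_univ _⟩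
              (fun s => f (xs s) + L * |x - xs s|)}
      ⊆ {x | x ∈ D ∧ 0 <
          (if 0 < σ x then
            (μ x - (Finset.univ : Finset (Fin S)).sup' ⟨⟨0, hS⟩, Finset.mem_univ _⟩
                (fun s => f (xs s)) - ξ)
              * stdNormalCDF ((μ x - (Finset.univ : Finset (Fin S)).sup'
                  ⟨⟨0, hS⟩, Finset.mem_univ _⟩ (fun s => f (xs s)) - ξ) / σ x)
            + σ x * stdNormalPDF ((μ x - (Finset.univ : Finset (Fin S)).sup'
                  ⟨⟨0, hS⟩, Finset.mem_univ _⟩ (fun s => f (xs s)) - ξ) / σ x)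
          else 0)} := by
  rintro x ⟨hxD, hx⟩
  refine ⟨hxD, ?_⟩
  have hσ : 0 < σ x := by
    refine (hσnonneg x hxD).lt_of_ne fun h => ?_
    obtain ⟨s, rfl⟩ := hσzero x hxD h.symm
    have hinf := Finset.inf'_le (fun t => f (xs t) + L * |xs s - xs t|) (Finset.mem_univ s)
    have hsup := Finset.le_sup' (fun t => f (xs t)) (Finset.mem_univ s)
    simp only [sub_self, abs_zero, mul_zero, add_zero] at hinf
    exact absurd hx (hinf.trans hsup).not_gt
  rw [if_pos hσ]
  generalize μ x - _ - ξ = w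
  have h := mul_pos hσ (mul_stdNormalCDF_add_stdNormalPDF_pos (w / σ x))
  rwa [mul_add, ← mul_assoc, mul_div_cancel₀ _ hσ.ne'] at h
end

section
/- Let 0 < x_1 < x_2 < ⋯ < x_S < 1 with S ≥ 3, let λ ≠ 0, and let K be the S×S matrix with entries K_{ij} = λ²·min(x_i, x_j)·(1 − max(x_i, x_j)) (the Gram matrix of the Dirichlet kernel). Then K is invertible and K⁻¹ is the symmetric tridiagonal matrix with diagonal entries (K⁻¹)_{1,1} = λ⁻²·x_2/(x_1·(x_2 − x_1)), (K⁻¹)_{s,s} = λ⁻²·(x_{s+1} − x_{s−1})/((x_s − x_{s−1})·(x_{s+1} − x_s)) for 2 ≤ s ≤ S−1, (K⁻¹)_{S,S} = λ⁻²·(1 − x_{S−1})/((1 − x_S)·(x_S − x_{S−1})), off-diagonal entries (K⁻¹)_{s−1,s} = (K⁻¹)_{s,s−1} = −λ⁻²/(x_s − x_{s−1}) for 2 ≤ s ≤ S, and all other entries zero. -/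
/-- The action of a row of a tridiagonal matrix on a vector. -/
lemma sum_tridiagonal_row {R : Type*} [NonUnitalNonAssocSemiring R] {n i : ℕ} (hi : i < n)
    (a : R) (c f : ℕ → R) :
    ∑ j : Fin n, (if i = (j : ℕ) then a else if i + 1 = (j : ℕ) ∨ (j : ℕ) + 1 = i then c j else 0)
        * f j =
      a * f i + (if i + 1 < n then c (i + 1) * f (i + 1) else 0)
        + (if 0 < i then c (i - 1) * f (i - 1) else 0) := by
  rw [Fin.sum_univ_eq_sum_range
    (fun j => (if i = j then a else if i + 1 = j ∨ j + 1 = i then c j else 0) * f j) n]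
  have split_entry : ∀ j ∈ Finset.range n,
      (if i = j then a else if i + 1 = j ∨ j + 1 = i then c j else 0) * f j =
        (if i = j then a * f j else 0) + (if i + 1 = j then c j * f j else 0)
          + (if i - 1 = j then if 0 < i then c j * f j else 0 else 0) := by
    intro j _
    by_cases h₀ : i = j
    · have : ¬ (i - 1 = j ∧ 0 < i) := by omega
      have : ¬ i + 1 = j := by omega
      split_ifs <;> simp_all
    · by_cases h₁ : i + 1 = j
      · have : ¬ i - 1 = j := by omega
        simp [h₀, h₁, this]
      · by_cases h₂ : j + 1 = i
        · have : i - 1 = j := by omega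
          have : 0 < i := by omega
          simp [*]
        · have : ¬ (i - 1 = j ∧ 0 < i) := by omega
          split_ifs <;> simp_all
  rw [Finset.sum_congr rfl split_entry, Finset.sum_add_distrib, Finset.sum_add_distrib,
    Finset.sum_ite_eq, Finset.sum_ite_eq, Finset.sum_ite_eq]
  have : i - 1 < n := by omega
  simp [hi, this]

/-- the Gram matrix of the Dirichlet kernel on ordered points
`0 < x_1 < ⋯ < x_S < 1` is invertible, and its inverse is the stated symmetric
tridiagonal matrix.  (Indices here are 0-based: `i : Fin S` corresponds to the
1-based index `i + 1` of the statement.) -/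
theorem dirichlet_gram_matrix_inverse
    (S : ℕ) (hS : 3 ≤ S) (xs : ℕ → ℝ) (lam : ℝ) (hlam : lam ≠ 0)
    (hpos : 0 < xs 0) (hlt1 : xs (S - 1) < 1)
    (hmono : ∀ i j, i < j → j < S → xs i < xs j)
    (K : Matrix (Fin S) (Fin S) ℝ)
    (hK : ∀ i j : Fin S,
      K i j = lam ^ 2 * min (xs i) (xs j) * (1 - max (xs i) (xs j))) :
    IsUnit K ∧
    K⁻¹ = Matrix.of (fun i j : Fin S =>
      if (i : ℕ) = (j : ℕ) then
        if (i : ℕ) = 0 then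
          (lam ^ 2)⁻¹ * xs 1 / (xs 0 * (xs 1 - xs 0))
        else if (i : ℕ) = S - 1 then
          (lam ^ 2)⁻¹ * (1 - xs (S - 2)) / ((1 - xs (S - 1)) * (xs (S - 1) - xs (S - 2)))
        else
          (lam ^ 2)⁻¹ * (xs ((i : ℕ) + 1) - xs ((i : ℕ) - 1))
            / ((xs i - xs ((i : ℕ) - 1)) * (xs ((i : ℕ) + 1) - xs i))
      else if (i : ℕ) + 1 = (j : ℕ) ∨ (j : ℕ) + 1 = (i : ℕ) then
        -(lam ^ 2)⁻¹ / (xs (max (i : ℕ) (j : ℕ)) - xs (min (i : ℕ) (j : ℕ)))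
      else 0) := by
  refine (fun hMK => ⟨IsUnit.of_mul_eq_one_right _ hMK, Matrix.inv_eq_left_inv hMK⟩) ?_
  ext ⟨i, hi⟩ ⟨k, hk⟩
  set f : ℕ → ℝ := fun j => lam ^ 2 * min (xs j) (xs k) * (1 - max (xs j) (xs k)) with hf
  have hle : ∀ {a b}, a ≤ b → b < S → xs a ≤ xs b := fun {a b} hab hb => by
    rcases hab.eq_or_lt with rfl | h
    · exact le_rfl
    · exact (hmono _ _ h hb).le
  have f_of_le : ∀ j, j ≤ k → f j = lam ^ 2 * xs j * (1 - xs k) := fun j hj => by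
    simp only [hf, min_eq_left (hle hj hk), max_eq_right (hle hj hk)]
  have f_of_ge : ∀ j, k ≤ j → j < S → f j = lam ^ 2 * xs k * (1 - xs j) := fun j hj hjS => by
    simp only [hf, min_eq_right (hle hj hjS), max_eq_left (hle hj hjS)]
  simp only [Matrix.mul_apply, Matrix.of_apply, hK, Matrix.one_apply, Fin.mk.injEq]
  rw [sum_tridiagonal_row hi _ (fun j => -(lam ^ 2)⁻¹ / (xs (max i j) - xs (min i j))) f]
  rcases Nat.eq_zero_or_pos i with rfl | hi0
  · have d₁ : xs 1 - xs 0 ≠ 0 := (sub_pos.2 (hmono 0 1 (by omega) (by omega))).ne'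
    have hS1 : 0 + 1 < S := by omega
    simp only [if_true, hS1, lt_irrefl, if_false, zero_add, Nat.zero_max, Nat.zero_min, add_zero]
    rcases Nat.eq_zero_or_pos k with rfl | hk0
    · rw [f_of_le 0 le_rfl, f_of_ge 1 (by omega) (by omega), if_pos rfl]
      field_simp
      ring
    · rw [f_of_le 0 (by omega), f_of_le 1 (by omega), if_neg (by omega)]
      field_simp
      ring
  obtain ⟨p, rfl⟩ : ∃ p, i = p + 1 := ⟨i - 1, by omega⟩
  have d₀ : xs (p + 1) - xs p ≠ 0 := (sub_pos.2 (hmono p (p + 1) (by omega) hi)).ne'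
  have hmax : max (p + 1) p = p + 1 := by omega
  have hmin : min (p + 1) p = p := by omega
  have hmax' : max (p + 1) (p + 1 + 1) = p + 1 + 1 := by omega
  have hmin' : min (p + 1) (p + 1 + 1) = p + 1 := by omega
  simp only [hi0, if_true, hi0.ne', if_false, Nat.add_sub_cancel, hmax, hmin, hmax', hmin']
  by_cases hlast : p + 1 = S - 1
  · have hS2 : S - 2 = p := by omega
    have d₁ : 1 - xs (p + 1) ≠ 0 := by rw [hlast]; exact (sub_pos.2 hlt1).ne'
    rw [if_pos hlast, if_neg (by omega), hS2, ← hlast]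
    rcases Nat.lt_or_ge p k with hpk | hkp
    · obtain rfl : k = p + 1 := by omega
      rw [f_of_le p (by omega), f_of_le (p + 1) le_rfl, if_pos rfl]
      field_simp
      ring
    · rw [f_of_ge p hkp (by omega), f_of_ge (p + 1) (by omega) hi, if_neg (by omega)]
      field_simp
      ring
  · have hi' : p + 1 + 1 < S := by omega
    have d₁ : xs (p + 1 + 1) - xs (p + 1) ≠ 0 :=
      (sub_pos.2 (hmono (p + 1) (p + 1 + 1) (by omega) hi')).ne'
    rw [if_neg hlast, if_pos hi']
    rcases lt_trichotomy k (p + 1) with hkp | rfl | hpk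
    · rw [f_of_ge p (by omega) (by omega), f_of_ge (p + 1) (by omega) hi,
        f_of_ge (p + 1 + 1) (by omega) hi', if_neg (by omega)]
      field_simp
      ring
    · rw [f_of_le p (by omega), f_of_le (p + 1) le_rfl,
        f_of_ge (p + 1 + 1) (by omega) hi', if_pos rfl]
      field_simp
      ring
    · rw [f_of_le p (by omega), f_of_le (p + 1) (by omega),
        f_of_le (p + 1 + 1) (by omega), if_neg (by omega)]
      field_simp
      ring
end

section
/- Let 0 < x_1 < ⋯ < x_S < 1 with S ≥ 3, let λ ≠ 0, let K be the S×S Gram matrix of the Dirichlet kernel K_{ij} = λ²·min(x_i, x_j)·(1 − max(x_i, x_j)), and fix s ∈ {2, …, S}. For x ∈ [x_{s−1}, x_s], let κ(x) ∈ ℝ^S be the vector with entries κ(x)_j = λ²·min(x_j, x)·(1 − max(x_j, x)). Then the row vector κ(x)ᵀ·K⁻¹ has exactly two (possibly) nonzero entries: entry s−1 equals (x_s − x)/(x_s − x_{s−1}) and entry s equals (x − x_{s−1})/(x_s − x_{s−1}); consequently, for any y ∈ ℝ^S, the posterior mean κ(x)ᵀ·K⁻¹·y equals the linear interpolation (y_{s−1}·(x_s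 − x) + y_s·(x − x_{s−1}))/(x_s − x_{s−1}). -/
open Matrix

/-- The Dirichlet kernel on `[0, 1]` with scale `lam`. -/
noncomputable def dirichletKernel (lam t u : ℝ) : ℝ :=
  lam ^ 2 * min t u * (1 - max t u)

lemma dirichletKernel_of_le (lam : ℝ) {t u : ℝ} (h : t ≤ u) :
    dirichletKernel lam t u = lam ^ 2 * t * (1 - u) := by
  rw [dirichletKernel, min_eq_left h, max_eq_right h]

lemma dirichletKernel_of_ge (lam : ℝ) {t u : ℝ} (h : u ≤ t) :
    dirichletKernel lam t u = lam ^ 2 * u * (1 - t) := by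
  rw [dirichletKernel, min_eq_right h, max_eq_left h]

/-- The Dirichlet kernel is affine in its second argument on intervals whose interior does not
contain the first argument. -/
lemma dirichletKernel_interpolation (lam : ℝ) {a b x t : ℝ} (hax : a ≤ x) (hxb : x ≤ b)
    (ht : t ≤ a ∨ b ≤ t) :
    dirichletKernel lam t x * (b - a) =
      dirichletKernel lam t a * (b - x) + dirichletKernel lam t b * (x - a) := by
  rcases ht with ht | ht
  · rw [dirichletKernel_of_le lam ht, dirichletKernel_of_le lam (ht.trans hax),
      dirichletKernel_of_le lam (ht.trans (hax.trans hxb))]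
    ring
  · rw [dirichletKernel_of_ge lam ht, dirichletKernel_of_ge lam (hxb.trans ht),
      dirichletKernel_of_ge lam ((hax.trans hxb).trans ht)]
    ring

/-- The defect of linear interpolation of the Dirichlet kernel at its kink. -/
lemma dirichletKernel_self_interpolation_defect (lam : ℝ) {a b c : ℝ} (hab : a ≤ b)
    (hbc : b ≤ c) :
    dirichletKernel lam b b * (c - a) =
      dirichletKernel lam b a * (c - b) + dirichletKernel lam b c * (b - a) +
        lam ^ 2 * (b - a) * (c - b) := by
  rw [dirichletKernel_of_le lam le_rfl, dirichletKernel_of_ge lam hab,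
    dirichletKernel_of_le lam hbc]
  ring

/-- A combination of kernel functions that vanishes at `a < xs j < c`, where no other centre lies
in `(a, c)`, has zero coefficient at `j`. -/
lemma coeff_eq_zero_of_sum_dirichletKernel_eq_zero {ι : Type*} [Fintype ι] {lam : ℝ}
    (hlam : lam ≠ 0) (xs v : ι → ℝ) (j : ι) {a c : ℝ} (ha : a < xs j) (hc : xs j < c)
    (hsep : ∀ i, i ≠ j → xs i ≤ a ∨ c ≤ xs i)
    (hfa : ∑ i, v i * dirichletKernel lam (xs i) a = 0)
    (hfj : ∑ i, v i * dirichletKernel lam (xs i) (xs j) = 0)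
    (hfc : ∑ i, v i * dirichletKernel lam (xs i) c = 0) : v j = 0 := by
  have hsum : ∑ i, v i * (dirichletKernel lam (xs i) (xs j) * (c - a) -
      dirichletKernel lam (xs i) a * (c - xs j) -
      dirichletKernel lam (xs i) c * (xs j - a)) = 0 := by
    simp only [mul_sub (v _), ← mul_assoc, Finset.sum_sub_distrib, ← Finset.sum_mul, hfa, hfj, hfc]
    ring
  rw [Finset.sum_eq_single j] at hsum
  · rw [dirichletKernel_self_interpolation_defect lam ha.le hc.le] at hsum
    have hdefect : lam ^ 2 * (xs j - a) * (c - xs j) ≠ 0 :=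
      mul_ne_zero (mul_ne_zero (pow_ne_zero 2 hlam) (sub_pos.2 ha).ne') (sub_pos.2 hc).ne'
    refine (mul_eq_zero.1 ?_).resolve_right hdefect
    linear_combination hsum
  · intro i _ hij
    rw [dirichletKernel_interpolation lam ha.le hc.le (hsep i hij)]
    ring
  · simp

/-- The Gram matrix of the Dirichlet kernel at distinct points of `(0, 1)` is nonsingular. -/
lemma det_dirichletKernel_gram_ne_zero {S : ℕ} {lam : ℝ} (hlam : lam ≠ 0) {xs : Fin S → ℝ}
    (hmono : StrictMono xs) (hpos : ∀ i, 0 < xs i) (hlt : ∀ i, xs i < 1) :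
    (Matrix.of fun i j => dirichletKernel lam (xs i) (xs j)).det ≠ 0 := by
  intro hdet
  obtain ⟨v, hv, hvK⟩ := Matrix.exists_vecMul_eq_zero_iff.2 hdet
  have hf (j : Fin S) : ∑ i, v i * dirichletKernel lam (xs i) (xs j) = 0 := congrFun hvK j
  refine hv (funext fun j => ?_)
  obtain ⟨a, haj, hfa, ha⟩ : ∃ a < xs j, ∑ i, v i * dirichletKernel lam (xs i) a = 0 ∧
      ∀ i < j, xs i ≤ a := by
    by_cases hj : (j : ℕ) = 0
    · refine ⟨0, hpos j, Finset.sum_eq_zero fun i _ => ?_, fun i hi => ?_⟩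
      · rw [dirichletKernel_of_ge lam (hpos i).le]
        ring
      · have := Fin.lt_def.1 hi
        omega
    · refine ⟨xs ⟨j - 1, by omega⟩, hmono (Fin.lt_def.2 (Nat.sub_one_lt hj)), hf _,
        fun i hi => hmono.monotone (Fin.le_def.2 ?_)⟩
      exact Nat.le_sub_one_of_lt hi
  obtain ⟨c, hjc, hfc, hc⟩ : ∃ c, xs j < c ∧ ∑ i, v i * dirichletKernel lam (xs i) c = 0 ∧
      ∀ i, j < i → c ≤ xs i := by
    by_cases hj : (j : ℕ) + 1 < S
    · exact ⟨xs ⟨j + 1, hj⟩, hmono (Fin.lt_def.2 (Nat.lt_succ_self _)), hf _,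
        fun i hi => hmono.monotone (Fin.le_def.2 hi)⟩
    · refine ⟨1, hlt j, Finset.sum_eq_zero fun i _ => ?_, fun i hi => ?_⟩
      · rw [dirichletKernel_of_le lam (hlt i).le]
        ring
      · have := Fin.lt_def.1 hi
        omega
  exact coeff_eq_zero_of_sum_dirichletKernel_eq_zero hlam xs v j haj hjc
    (fun i hij => hij.lt_or_gt.imp (ha i) (hc i)) hfa (hf j) hfc

/-- for `x` between two consecutive observation points, the row vector
`κ(x)ᵀ·K⁻¹` has exactly two (possibly) nonzero entries, and the posterior mean
`κ(x)ᵀ·K⁻¹·y` is the linear interpolation of the neighboring observation values.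
(Indices are 0-based: the interval is `[x_{s−1}, x_s]` with `1 ≤ s ≤ S − 1`.) -/
theorem dirichlet_posterior_mean_interpolation
    (S : ℕ) (hS : 3 ≤ S) (xs : ℕ → ℝ) (lam : ℝ) (hlam : lam ≠ 0)
    (hpos : 0 < xs 0) (hlt1 : xs (S - 1) < 1)
    (hmono : ∀ i j, i < j → j < S → xs i < xs j)
    (K : Matrix (Fin S) (Fin S) ℝ)
    (hK : ∀ i j : Fin S,
      K i j = lam ^ 2 * min (xs i) (xs j) * (1 - max (xs i) (xs j)))
    (s : ℕ) (hs1 : 1 ≤ s) (hs2 : s < S)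
    (x : ℝ) (hx : x ∈ Set.Icc (xs (s - 1)) (xs s))
    (κx : Fin S → ℝ)
    (hκ : ∀ j : Fin S, κx j = lam ^ 2 * min (xs j) x * (1 - max (xs j) x)) :
    (Matrix.vecMul κx K⁻¹ = fun j : Fin S =>
      if (j : ℕ) = s - 1 then (xs s - x) / (xs s - xs (s - 1))
      else if (j : ℕ) = s then (x - xs (s - 1)) / (xs s - xs (s - 1))
      else 0) ∧
    ∀ y : Fin S → ℝ,
      Matrix.vecMul κx K⁻¹ ⬝ᵥ y
        = (y ⟨s - 1, by omega⟩ * (xs s - x) + y ⟨s, hs2⟩ * (x - xs (s - 1)))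
            / (xs s - xs (s - 1)) := by
  have hlt : xs (s - 1) < xs s := hmono _ _ (by omega) hs2
  have hle (i j : ℕ) (hij : i ≤ j) (hj : j < S) : xs i ≤ xs j := by
    rcases hij.eq_or_lt with rfl | h
    exacts [le_rfl, (hmono i j h hj).le]
  have hKof : K = Matrix.of fun i j : Fin S => dirichletKernel lam (xs i) (xs j) :=
    Matrix.ext hK
  have hdet : IsUnit K.det := by
    rw [hKof]
    exact (det_dirichletKernel_gram_ne_zero hlam (fun i j hij => hmono i j hij j.2)
      (fun i => hpos.trans_le (hle 0 i (Nat.zero_le _) i.2))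
      (fun i => (hle i (S - 1) (by omega) (by omega)).trans_lt hlt1)).isUnit
  set w : Fin S → ℝ := fun j =>
    if (j : ℕ) = s - 1 then (xs s - x) / (xs s - xs (s - 1))
    else if (j : ℕ) = s then (x - xs (s - 1)) / (xs s - xs (s - 1))
    else 0 with hw
  have hdot (y : Fin S → ℝ) : w ⬝ᵥ y =
      (y ⟨s - 1, by omega⟩ * (xs s - x) + y ⟨s, hs2⟩ * (x - xs (s - 1)))
        / (xs s - xs (s - 1)) := by
    have hne : (⟨s - 1, by omega⟩ : Fin S) ≠ ⟨s, hs2⟩ := by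
      rw [Ne, Fin.mk.injEq]
      omega
    rw [dotProduct, Fintype.sum_eq_add _ _ hne]
    · have hs : s ≠ s - 1 := by omega
      simp only [hw, if_true, if_neg hs]
      ring
    · rintro i ⟨hi, hi'⟩
      rw [Ne, Fin.ext_iff] at hi hi'
      simp only [hw, if_neg hi, if_neg hi', zero_mul]
  have hwK : κx = w ᵥ* K := by
    funext j
    have hsep : xs j ≤ xs (s - 1) ∨ xs s ≤ xs j := by
      rcases Nat.lt_or_ge j s with h | h
      · exact .inl (hle _ _ (by omega) (by omega))
      · exact .inr (hle _ _ h j.2)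
    have hKcomm (i : Fin S) : K i j = dirichletKernel lam (xs j) (xs i) := by
      rw [hK, min_comm, max_comm, dirichletKernel]
    rw [vecMul, hdot, hKcomm, hKcomm, eq_div_iff (sub_pos.2 hlt).ne', hκ]
    exact dirichletKernel_interpolation lam hx.1 hx.2 hsep
  have hmain : κx ᵥ* K⁻¹ = w := by
    rw [hwK, vecMul_vecMul, Matrix.mul_nonsing_inv K hdet, vecMul_one]
  exact ⟨hmain, fun y => hmain ▸ hdot y⟩
end

section
/- Let 0 ≤ a < b ≤ 1, L ≥ 0, λ ≥ L, and y_a, y_b ∈ ℝ with |y_b − y_a| ≤ L·(b − a). Then for every x ∈ [a, b]: (y_a·(b − x) + y_b·(x − a))/(b − a) + λ·√((b − x)·(x − a)/(b − a)) ≥ min(y_a + L·(x − a), y_b + L·(b − x)). In words, on each interval between consecutive Lipschitz-consistent observations, the Dirichlet-kernel posterior mean plus one posterior standard deviation dominates the Lipschitz upper bound function whenever the kernel scale λ is at least the Lipschitz constant L. -/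
/-- on the interval between two consecutive Lipschitz-consistent
observations `a < b` in `[0, 1]`, the Dirichlet-kernel posterior mean plus one posterior
standard deviation dominates the Lipschitz upper bound whenever the kernel scale
`λ ≥ L`. -/
theorem mean_plus_dev_dominates_on_interval
    (a b L lam ya yb : ℝ) (ha : 0 ≤ a) (hab : a < b) (hb : b ≤ 1)
    (hL : 0 ≤ L) (hlam : L ≤ lam)
    (hlip : |yb - ya| ≤ L * (b - a)) :
    ∀ x ∈ Set.Icc a b,
      min (ya + L * (x - a)) (yb + L * (b - x))
        ≤ (ya * (b - x) + yb * (x - a)) / (b - a)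
            + lam * Real.sqrt ((b - x) * (x - a) / (b - a)) := by
  rintro x ⟨hax, hxb⟩
  have hh : 0 < b - a := sub_pos.2 hab
  have hu : 0 ≤ x - a := sub_nonneg.2 hax
  have hv : 0 ≤ b - x := sub_nonneg.2 hxb
  set t := (b - x) * (x - a) / (b - a) with ht
  have ht0 : 0 ≤ t := div_nonneg (mul_nonneg hv hu) hh.le
  have ht4 : 4 * t ≤ 1 := by
    have : t ≤ 1 / 4 := by
      rw [ht, div_le_iff₀ hh]
      nlinarith [sq_nonneg ((b - x) - (x - a)), mul_nonneg hh.le (by linarith : 0 ≤ 1 - (b - a))]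
    linarith
  have hsqrt : 2 * t ≤ Real.sqrt t := Real.le_sqrt_of_sq_le (by nlinarith)
  -- The minimum is at most the convex combination with weights `(b - x)/(b - a)`, `(x - a)/(b - a)`.
  have hmin : min (ya + L * (x - a)) (yb + L * (b - x))
      ≤ (ya * (b - x) + yb * (x - a)) / (b - a) + L * (2 * t) := by
    have hcomb : (ya * (b - x) + yb * (x - a)) / (b - a) + L * (2 * t)
        = ((ya + L * (x - a)) * (b - x) + (yb + L * (b - x)) * (x - a)) / (b - a) := by
      rw [ht]
      ring
    rw [hcomb, le_div_iff₀ hh]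
    have h₁ := mul_le_mul_of_nonneg_right (min_le_left (ya + L * (x - a)) (yb + L * (b - x))) hv
    have h₂ := mul_le_mul_of_nonneg_right (min_le_right (ya + L * (x - a)) (yb + L * (b - x))) hu
    linarith
  have hdev : L * (2 * t) ≤ lam * Real.sqrt t :=
    mul_le_mul hlam hsqrt (by positivity) (hL.trans hlam)
  linarith
end

section
/- Let S ≥ 3, let 0 = x_1 < x_2 < ⋯ < x_S = 1 be observation points with values y_1, …, y_S satisfying |y_i − y_j| ≤ L·|x_i − x_j| for all i, j (Lipschitz consistency with constant L ≥ 0), and let λ ≥ L. Define μ, σ : [0, 1] → ℝ piecewise: for x ∈ [x_{s−1}, x_s] (s = 2, …, S), μ(x) = (y_{s−1}·(x_s − x) + y_s·(x − x_{s−1}))/(x_s − x_{s−1}) and σ(x) = λ·√((x_s − x)·(x − x_{s−1})/(x_s − x_{s−1})). Then μ(x) + σ(x) ≥ ū(x) for every x ∈ [0, 1], where ū(x) = min_{1≤s≤S} (y_s + L·|x − x_s|). -/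
/-- A point between `u 0` and `u (n + 1)` lies between two consecutive terms of `u`. -/
lemma exists_consecutive_of_le_of_le (u : ℕ → ℝ) (x : ℝ) (h0 : u 0 ≤ x) (n : ℕ)
    (hn : x ≤ u (n + 1)) : ∃ k ≤ n, u k ≤ x ∧ x ≤ u (k + 1) := by
  induction n with
  | zero => exact ⟨0, le_rfl, h0, hn⟩
  | succ n ih =>
    rcases le_total x (u (n + 1)) with h | h
    · obtain ⟨k, hk, hux⟩ := ih h
      exact ⟨k, hk.trans n.le_succ, hux⟩
    · exact ⟨n + 1, le_rfl, h, hn⟩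

/-- The harmonic mean of two nonnegative numbers with sum at most `1` is at most the square root
of half of it. -/
lemma two_mul_mul_div_add_le_sqrt {a b : ℝ} (ha : 0 ≤ a) (hb : 0 ≤ b) (hpos : 0 < a + b)
    (hle : a + b ≤ 1) : 2 * (a * b / (a + b)) ≤ √(a * b / (a + b)) := by
  have hq : 0 ≤ a * b / (a + b) := by positivity
  have hq4 : 4 * (a * b / (a + b)) ≤ 1 := by
    rw [← mul_div_assoc, div_le_one hpos]
    nlinarith [sq_nonneg (a - b)]
  apply Real.le_sqrt_of_sq_le
  nlinarith

/-- The smaller of the two Lipschitz upper bounds issued from the endpoints of an interval of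
length `a + b ≤ 1` is at most the linear interpolation plus the Brownian bridge deviation. -/
lemma min_le_interpolation_add_sqrt {a b L lam p q : ℝ} (ha : 0 ≤ a) (hb : 0 ≤ b)
    (hpos : 0 < a + b) (hle : a + b ≤ 1) (hL : 0 ≤ L) (hlam : L ≤ lam) :
    min (p + L * a) (q + L * b) ≤
      (p * b + q * a) / (a + b) + lam * √(a * b / (a + b)) := by
  have hmin : min (p + L * a) (q + L * b) ≤
      (p * b + q * a) / (a + b) + L * (2 * (a * b / (a + b))) := by
    have heq : (p * b + q * a) / (a + b) + L * (2 * (a * b / (a + b))) =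
        ((p + L * a) * b + (q + L * b) * a) / (a + b) := by ring
    rw [heq, le_div_iff₀ hpos]
    nlinarith [mul_le_mul_of_nonneg_right (min_le_left (p + L * a) (q + L * b)) hb,
      mul_le_mul_of_nonneg_right (min_le_right (p + L * a) (q + L * b)) ha]
  have hdev := mul_le_mul hlam (two_mul_mul_div_add_le_sqrt ha hb hpos hle) (by positivity)
    (hL.trans hlam)
  linarith

/-- with observation points `0 = x_1 < ⋯ < x_S = 1` (0-indexed here:
`xs 0 = 0`, `xs (S−1) = 1`), Lipschitz-consistent values, and kernel scale `λ ≥ L`,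
the piecewise Dirichlet-kernel posterior mean plus one posterior standard deviation
dominates the Lipschitz upper bound function `ū` on all of `[0, 1]`. -/
theorem mean_plus_dev_dominates_upper_bound
    (S : ℕ) (hS : 3 ≤ S) (L lam : ℝ) (hL : 0 ≤ L) (hlam : L ≤ lam)
    (xs ys : ℕ → ℝ) (hx0 : xs 0 = 0) (hx1 : xs (S - 1) = 1)
    (hmono : ∀ i j, i < j → j < S → xs i < xs j)
    (hlip : ∀ i < S, ∀ j < S, |ys i - ys j| ≤ L * |xs i - xs j|)
    (μ σ : ℝ → ℝ)
    (hμσ : ∀ s, 1 ≤ s → s < S → ∀ x ∈ Set.Icc (xs (s - 1)) (xs s),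
      μ x = (ys (s - 1) * (xs s - x) + ys s * (x - xs (s - 1))) / (xs s - xs (s - 1)) ∧
      σ x = lam * Real.sqrt ((xs s - x) * (x - xs (s - 1)) / (xs s - xs (s - 1)))) :
    ∀ x ∈ Set.Icc (0 : ℝ) 1,
      (Finset.range S).inf' (Finset.nonempty_range_iff.mpr (by omega))
          (fun s => ys s + L * |x - xs s|)
        ≤ μ x + σ x := by
  rintro x ⟨hx0', hx1'⟩
  obtain ⟨n, rfl⟩ : ∃ n, S = n + 2 := ⟨S - 2, by omega⟩
  obtain ⟨k, hk, hkx, hxk⟩ := exists_consecutive_of_le_of_le xs x (hx0 ▸ hx0') n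
    (by simpa using hx1'.trans_eq hx1.symm)
  have hstep : xs k < xs (k + 1) := hmono k (k + 1) k.lt_succ_self (by omega)
  have hk0 : 0 ≤ xs k := by
    rcases k.eq_zero_or_pos with rfl | h
    · exact hx0.ge
    · exact hx0 ▸ (hmono 0 k h (by omega)).le
  have hk1 : xs (k + 1) ≤ 1 := by
    rcases hk.eq_or_lt with rfl | h
    · exact hx1.le
    · exact hx1 ▸ (hmono (k + 1) (n + 2 - 1) (by omega) (by omega)).le
  obtain ⟨hμ, hσ⟩ := hμσ (k + 1) (by omega) (by omega) x ⟨hkx, hxk⟩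
  have hlen : xs (k + 1) - xs k = (x - xs k) + (xs (k + 1) - x) := by ring
  rw [hμ, hσ, Nat.add_sub_cancel, mul_comm (xs (k + 1) - x) (x - xs k), hlen]
  refine le_trans (le_min ?_ ?_) (min_le_interpolation_add_sqrt (sub_nonneg.2 hkx)
    (sub_nonneg.2 hxk) (by linarith) (by linarith) hL hlam)
  · refine (Finset.inf'_le _ (Finset.mem_range.2 (by omega : k < n + 2))).trans_eq ?_
    rw [abs_of_nonneg (sub_nonneg.2 hkx)]
  · refine (Finset.inf'_le _ (Finset.mem_range.2 (by omega : k + 1 < n + 2))).trans_eq ?_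
    rw [abs_of_nonpos (sub_nonpos.2 hxk), neg_sub]
end
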